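/- arXiv:cond-mat/0703319 — 2 statements merged into one kernel-verified Lean document; each statement's English description precedes it below -/
import Mathlib

section
/- Let L ≥ 1, η ∈ ℂ, and λ, μ ∈ ℂ with sinh(λ+η) ≠ 0, sinh(μ+η) ≠ 0 and sinh(λ−μ+η) ≠ 0. Then on ℂ²_a ⊗ ℂ²_b ⊗ (ℂ²)^{⊗L} (two auxiliary factors a, b and L quantum sites) the monodromy matrices satisfy the exchange (RTT) relation R_{ab}(λ−μ) 𝒯_a(λ) 𝒯_b(μ) = 𝒯_b(μ) 𝒯_a(λ) R_{ab}(λ−μ), where 𝒯_a(λ) acts as the identity on factor b and 𝒯_b(μ) acts as the identity on factor a. -/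
open Complex Matrix

/-- The six-vertex R-matrix on ℂ² ⊗ ℂ², in the basis `e₁⊗e₁, e₁⊗e₂, e₂⊗e₁, e₂⊗e₂`
(encoded as pairs `(0,0), (0,1), (1,0), (1,1)` in `Fin 2 × Fin 2`). -/
noncomputable def Rmat (η lam : ℂ) : Matrix (Fin 2 × Fin 2) (Fin 2 × Fin 2) ℂ :=
  Matrix.of fun p q =>
    if p = q then (if p.1 = p.2 then 1 else Complex.sinh lam / Complex.sinh (lam + η))
    else if p.1 = q.2 ∧ p.2 = q.1 ∧ p.1 ≠ p.2 then Complex.sinh η / Complex.sinh (lam + η)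
    else 0

/-- Basis states of the chain `(ℂ²)^{⊗L}`. -/
abbrev Chain (L : ℕ) := Fin L → Fin 2

/-- `R_{aj}(λ)`: the R-matrix acting on the auxiliary factor and the `j`-th site of the
chain, and as the identity on all other sites. -/
noncomputable def Raux (L : ℕ) (η lam : ℂ) (j : Fin L) :
    Matrix (Fin 2 × Chain L) (Fin 2 × Chain L) ℂ :=
  Matrix.of fun p q =>
    Rmat η lam (p.1, p.2 j) (q.1, q.2 j) * (if ∀ k, k ≠ j → p.2 k = q.2 k then 1 else 0)

/-- The monodromy matrix `𝒯_a(λ) = R_{aL}(λ) ⋯ R_{a2}(λ) R_{a1}(λ)` on `ℂ²_a ⊗ (ℂ²)^{⊗L}`. -/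
noncomputable def monodromy (L : ℕ) (η lam : ℂ) :
    Matrix (Fin 2 × Chain L) (Fin 2 × Chain L) ℂ :=
  ((List.ofFn fun j : Fin L => Raux L η lam j).reverse).prod

/-- `A(λ)`, the upper-left block of the monodromy matrix w.r.t. the auxiliary space. -/
noncomputable def Aop (L : ℕ) (η lam : ℂ) : Matrix (Chain L) (Chain L) ℂ :=
  Matrix.of fun v w => monodromy L η lam (0, v) (0, w)

/-- `B(λ)`, the upper-right block of the monodromy matrix w.r.t. the auxiliary space. -/
noncomputable def Bop (L : ℕ) (η lam : ℂ) : Matrix (Chain L) (Chain L) ℂ :=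
  Matrix.of fun v w => monodromy L η lam (0, v) (1, w)

/-- `C(λ)`, the lower-left block of the monodromy matrix w.r.t. the auxiliary space. -/
noncomputable def Cop (L : ℕ) (η lam : ℂ) : Matrix (Chain L) (Chain L) ℂ :=
  Matrix.of fun v w => monodromy L η lam (1, v) (0, w)

/-- `D(λ)`, the lower-right block of the monodromy matrix w.r.t. the auxiliary space. -/
noncomputable def Dop (L : ℕ) (η lam : ℂ) : Matrix (Chain L) (Chain L) ℂ :=
  Matrix.of fun v w => monodromy L η lam (1, v) (1, w)

/-- The transfer matrix `T(λ) = Tr_a 𝒯_a(λ) = A(λ) + D(λ)` on `(ℂ²)^{⊗L}`. -/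
noncomputable def transfer (L : ℕ) (η lam : ℂ) : Matrix (Chain L) (Chain L) ℂ :=
  Matrix.of fun v w => ∑ a : Fin 2, monodromy L η lam (a, v) (a, w)

/-- `𝒯_a(λ)` acting on `ℂ²_a ⊗ ℂ²_b ⊗ (ℂ²)^{⊗L}`, as the identity on the factor `b`. -/
noncomputable def monodromyA (L : ℕ) (η lam : ℂ) :
    Matrix (Fin 2 × Fin 2 × Chain L) (Fin 2 × Fin 2 × Chain L) ℂ :=
  Matrix.of fun p q =>
    monodromy L η lam (p.1, p.2.2) (q.1, q.2.2) * (if p.2.1 = q.2.1 then 1 else 0)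

/-- `𝒯_b(μ)` acting on `ℂ²_a ⊗ ℂ²_b ⊗ (ℂ²)^{⊗L}`, as the identity on the factor `a`. -/
noncomputable def monodromyB (L : ℕ) (η lam : ℂ) :
    Matrix (Fin 2 × Fin 2 × Chain L) (Fin 2 × Fin 2 × Chain L) ℂ :=
  Matrix.of fun p q =>
    monodromy L η lam (p.2.1, p.2.2) (q.2.1, q.2.2) * (if p.1 = q.1 then 1 else 0)

/-- `R_{ab}(λ)` acting on the two auxiliary factors of `ℂ²_a ⊗ ℂ²_b ⊗ (ℂ²)^{⊗L}`. -/
noncomputable def Rab (L : ℕ) (η lam : ℂ) :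
    Matrix (Fin 2 × Fin 2 × Chain L) (Fin 2 × Fin 2 × Chain L) ℂ :=
  Matrix.of fun p q =>
    Rmat η lam (p.1, p.2.1) (q.1, q.2.1) * (if p.2.2 = q.2.2 then 1 else 0)

open scoped Kronecker

/-- The local six-vertex operator `R_{ab}` on three factors of `ℂ²`. -/
noncomputable def triAB (η lam : ℂ) :
    Matrix (Fin 2 × Fin 2 × Fin 2) (Fin 2 × Fin 2 × Fin 2) ℂ :=
  Matrix.of fun p q => Rmat η lam (p.1, p.2.1) (q.1, q.2.1) * (if p.2.2 = q.2.2 then 1 else 0)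

/-- The local six-vertex operator `R_{ac}` on three factors of `ℂ²`. -/
noncomputable def triAC (η lam : ℂ) :
    Matrix (Fin 2 × Fin 2 × Fin 2) (Fin 2 × Fin 2 × Fin 2) ℂ :=
  Matrix.of fun p q => Rmat η lam (p.1, p.2.2) (q.1, q.2.2) * (if p.2.1 = q.2.1 then 1 else 0)

/-- The local six-vertex operator `R_{bc}` on three factors of `ℂ²`. -/
noncomputable def triBC (η lam : ℂ) :
    Matrix (Fin 2 × Fin 2 × Fin 2) (Fin 2 × Fin 2 × Fin 2) ℂ :=
  Matrix.of fun p q => Rmat η lam (p.2.1, p.2.2) (q.2.1, q.2.2) * (if p.1 = q.1 then 1 else 0)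

/-- The relation `c c + b c b = c` between the six-vertex weights. -/
theorem sinh_weights_cc {η lam mu : ℂ} (h1 : Complex.sinh (lam + η) ≠ 0)
    (h2 : Complex.sinh (mu + η) ≠ 0) (h3 : Complex.sinh (lam - mu + η) ≠ 0) :
    (Complex.sinh η / Complex.sinh (lam - mu + η)) * (Complex.sinh η / Complex.sinh (mu + η)) +
      (Complex.sinh (lam - mu) / Complex.sinh (lam - mu + η)) * (Complex.sinh η / Complex.sinh (lam + η)) *
        (Complex.sinh mu / Complex.sinh (mu + η)) =
      (Complex.sinh η / Complex.sinh (lam + η)) := by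
  field_simp
  simp only [Complex.sinh, neg_add, sub_eq_add_neg, neg_neg, Complex.exp_add,
    Complex.exp_neg]
  have hl := Complex.exp_ne_zero lam
  have hm := Complex.exp_ne_zero mu
  have hη := Complex.exp_ne_zero η
  field_simp
  ring

/-- The relation `b c + c c b = b c` between the six-vertex weights. -/
theorem sinh_weights_bc {η lam mu : ℂ} (h1 : Complex.sinh (lam + η) ≠ 0)
    (h2 : Complex.sinh (mu + η) ≠ 0) (h3 : Complex.sinh (lam - mu + η) ≠ 0) :
    (Complex.sinh (lam - mu) / Complex.sinh (lam - mu + η)) * (Complex.sinh η / Complex.sinh (mu + η)) +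
      (Complex.sinh η / Complex.sinh (lam - mu + η)) * (Complex.sinh η / Complex.sinh (lam + η)) *
        (Complex.sinh mu / Complex.sinh (mu + η)) =
      (Complex.sinh lam / Complex.sinh (lam + η)) * (Complex.sinh η / Complex.sinh (mu + η)) := by
  field_simp
  simp only [Complex.sinh, neg_add, sub_eq_add_neg, neg_neg, Complex.exp_add,
    Complex.exp_neg]
  have hl := Complex.exp_ne_zero lam
  have hm := Complex.exp_ne_zero mu
  have hη := Complex.exp_ne_zero η
  field_simp
  ring

/-- The relation `c b + b c c = b c` between the six-vertex weights. -/
theorem sinh_weights_cb {η lam mu : ℂ} (h1 : Complex.sinh (lam + η) ≠ 0)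
    (h2 : Complex.sinh (mu + η) ≠ 0) (h3 : Complex.sinh (lam - mu + η) ≠ 0) :
    (Complex.sinh η / Complex.sinh (lam - mu + η)) * (Complex.sinh mu / Complex.sinh (mu + η)) +
      (Complex.sinh (lam - mu) / Complex.sinh (lam - mu + η)) * (Complex.sinh η / Complex.sinh (lam + η)) *
        (Complex.sinh η / Complex.sinh (mu + η)) =
      (Complex.sinh lam / Complex.sinh (lam + η)) * (Complex.sinh η / Complex.sinh (lam - mu + η)) := by
  field_simp
  simp only [Complex.sinh, neg_add, sub_eq_add_neg, neg_neg, Complex.exp_add,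
    Complex.exp_neg]
  have hl := Complex.exp_ne_zero lam
  have hm := Complex.exp_ne_zero mu
  have hη := Complex.exp_ne_zero η
  field_simp
  ring

set_option maxHeartbeats 1000000 in
/-- The Yang–Baxter equation for the six-vertex R-matrix. -/
theorem yang_baxter (η lam mu : ℂ) (h1 : Complex.sinh (lam + η) ≠ 0)
    (h2 : Complex.sinh (mu + η) ≠ 0) (h3 : Complex.sinh (lam - mu + η) ≠ 0) :
    triAB η (lam - mu) * triAC η lam * triBC η mu =
      triBC η mu * triAC η lam * triAB η (lam - mu) := by
  have E₁ := sinh_weights_cc h1 h2 h3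
  have E₂ := sinh_weights_bc h1 h2 h3
  have E₃ := sinh_weights_cb h1 h2 h3
  have hR : ∀ z, Rmat η z = Matrix.of fun p q =>
      if p = q then (if p.1 = p.2 then 1 else Complex.sinh z / Complex.sinh (z + η))
      else if p.1 = q.2 ∧ p.2 = q.1 ∧ p.1 ≠ p.2 then Complex.sinh η / Complex.sinh (z + η)
      else 0 := fun z => rfl
  simp only [triAB, triAC, triBC, hR]
  generalize Complex.sinh (lam - mu) / Complex.sinh (lam - mu + η) = b₁ at *
  generalize Complex.sinh η / Complex.sinh (lam - mu + η) = c₁ at *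
  generalize Complex.sinh lam / Complex.sinh (lam + η) = b₂ at *
  generalize Complex.sinh η / Complex.sinh (lam + η) = c₂ at *
  generalize Complex.sinh mu / Complex.sinh (mu + η) = b₃ at *
  generalize Complex.sinh η / Complex.sinh (mu + η) = c₃ at *
  ext ⟨p1, p2, p3⟩ ⟨q1, q2, q3⟩
  fin_cases p1 <;> fin_cases p2 <;> fin_cases p3 <;> fin_cases q1 <;> fin_cases q2 <;>
    fin_cases q3 <;>
    simp [Matrix.mul_apply, Fintype.sum_prod_type] <;> try ring1
  all_goals first
    | linear_combination E₁
    | linear_combination -E₁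
    | linear_combination E₂
    | linear_combination -E₂
    | linear_combination E₃
    | linear_combination -E₃

/-- Extension of an operator on `ℂ²_a ⊗ V` to `ℂ²_a ⊗ ℂ²_b ⊗ V`. -/
noncomputable def liftA (S : Type*) [Fintype S] [DecidableEq S] :
    Matrix (Fin 2 × S) (Fin 2 × S) ℂ →* Matrix (Fin 2 × Fin 2 × S) (Fin 2 × Fin 2 × S) ℂ where
  toFun M := Matrix.of fun p q => M (p.1, p.2.2) (q.1, q.2.2) * (if p.2.1 = q.2.1 then 1 else 0)
  map_one' := by
    ext ⟨a, b, s⟩ ⟨a', b', s'⟩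
    simp only [Matrix.of_apply, Matrix.one_apply, Prod.mk.injEq]
    split_ifs <;> simp_all
  map_mul' M N := by
    ext ⟨a, b, s⟩ ⟨a', b', s'⟩
    simp [Matrix.mul_apply, Fintype.sum_prod_type]

/-- Extension of an operator on `ℂ²_b ⊗ V` to `ℂ²_a ⊗ ℂ²_b ⊗ V`. -/
noncomputable def liftB (S : Type*) [Fintype S] [DecidableEq S] :
    Matrix (Fin 2 × S) (Fin 2 × S) ℂ →* Matrix (Fin 2 × Fin 2 × S) (Fin 2 × Fin 2 × S) ℂ where
  toFun M := Matrix.of fun p q => M (p.2.1, p.2.2) (q.2.1, q.2.2) * (if p.1 = q.1 then 1 else 0)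
  map_one' := by
    ext ⟨a, b, s⟩ ⟨a', b', s'⟩
    simp only [Matrix.of_apply, Matrix.one_apply, Prod.mk.injEq]
    split_ifs <;> simp_all
  map_mul' M N := by
    ext ⟨a, b, s⟩ ⟨a', b', s'⟩
    simp [Matrix.mul_apply, Fintype.sum_prod_type]

/-- The splitting of the `j`-th site from the rest of the chain. -/
def splitSite {L : ℕ} (j : Fin L) :
    (Fin 2 × Fin 2 × Chain L) ≃ (Fin 2 × Fin 2 × Fin 2) × ({k // k ≠ j} → Fin 2) where
  toFun p := ((p.1, p.2.1, p.2.2 j), fun k => p.2.2 k)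
  invFun r := (r.1.1, r.1.2.1, (Equiv.funSplitAt j (Fin 2)).symm (r.1.2.2, r.2))
  left_inv p := by
    have h := (Equiv.funSplitAt j (Fin 2)).symm_apply_apply p.2.2
    exact Prod.ext rfl (Prod.ext rfl h)
  right_inv r := by
    have h := (Equiv.funSplitAt j (Fin 2)).apply_symm_apply (r.1.2.2, r.2)
    have h₁ : (Equiv.funSplitAt j (Fin 2)).symm (r.1.2.2, r.2) j = r.1.2.2 := congrArg Prod.fst h
    exact Prod.ext (Prod.ext rfl (Prod.ext rfl h₁)) (congrArg Prod.snd h :)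

/-- A local operator on `ℂ²_a ⊗ ℂ²_b ⊗ ℂ²_j`, extended by the identity to the whole chain. -/
noncomputable def siteLift {L : ℕ} (j : Fin L)
    (M : Matrix (Fin 2 × Fin 2 × Fin 2) (Fin 2 × Fin 2 × Fin 2) ℂ) :
    Matrix (Fin 2 × Fin 2 × Chain L) (Fin 2 × Fin 2 × Chain L) ℂ :=
  (M ⊗ₖ (1 : Matrix ({k // k ≠ j} → Fin 2) ({k // k ≠ j} → Fin 2) ℂ)).submatrix
    (splitSite j) (splitSite j)

theorem siteLift_mul {L : ℕ} (j : Fin L)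
    (M N : Matrix (Fin 2 × Fin 2 × Fin 2) (Fin 2 × Fin 2 × Fin 2) ℂ) :
    siteLift j (M * N) = siteLift j M * siteLift j N := by
  rw [siteLift, siteLift, siteLift, Matrix.submatrix_mul_equiv, ← Matrix.mul_kronecker_mul, mul_one]

theorem siteLift_apply {L : ℕ} (j : Fin L)
    (M : Matrix (Fin 2 × Fin 2 × Fin 2) (Fin 2 × Fin 2 × Fin 2) ℂ)
    (p q : Fin 2 × Fin 2 × Chain L) :
    siteLift j M p q = M (p.1, p.2.1, p.2.2 j) (q.1, q.2.1, q.2.2 j) *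
      (if ∀ k, k ≠ j → p.2.2 k = q.2.2 k then 1 else 0) := by
  simp [siteLift, splitSite, Matrix.one_apply, funext_iff]

theorem liftA_Raux (L : ℕ) (η lam : ℂ) (j : Fin L) :
    liftA (Chain L) (Raux L η lam j) = siteLift j (triAC η lam) := by
  ext p q
  rw [siteLift_apply]
  exact mul_right_comm _ _ _

theorem liftB_Raux (L : ℕ) (η lam : ℂ) (j : Fin L) :
    liftB (Chain L) (Raux L η lam j) = siteLift j (triBC η lam) := by
  ext p q
  rw [siteLift_apply]
  exact mul_right_comm _ _ _

theorem Rab_eq_siteLift (L : ℕ) (η lam : ℂ) (j : Fin L) :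
    Rab L η lam = siteLift j (triAB η lam) := by
  ext p q
  rw [siteLift_apply]
  simp only [Rab, triAB, Matrix.of_apply, ← ite_and, mul_ite, mul_one, mul_zero]
  congr 1
  rw [eq_iff_iff, funext_iff]
  refine ⟨fun h => ⟨fun k _ => h k, h j⟩, fun h k => ?_⟩
  by_cases hk : k = j
  · exact hk ▸ h.2
  · exact h.1 k hk

/-- Local operators in different auxiliary factors and at different sites commute. -/
theorem commute_liftA_liftB_Raux (L : ℕ) (η lam mu : ℂ) {i j : Fin L} (hij : i ≠ j) :
    Commute (liftA (Chain L) (Raux L η lam i)) (liftB (Chain L) (Raux L η mu j)) := by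
  ext ⟨a, b, s⟩ ⟨a', b', t⟩
  rw [Matrix.mul_apply, Matrix.mul_apply,
    Finset.sum_eq_single (a', b, Function.update s i (t i)),
    Finset.sum_eq_single (a, b', Function.update s j (t j))]
  · simp only [liftA, liftB, Raux, MonoidHom.coe_mk, OneHom.coe_mk, Matrix.of_apply]
    have key : ∀ {i j : Fin L}, i ≠ j → ((∀ k, k ≠ j → Function.update s i (t i) k = t k) ↔
        ∀ k, k ≠ i → k ≠ j → s k = t k) := by
      intro i j hij
      refine forall_congr' fun k => ?_
      by_cases hk : k = i
      · subst hk; simp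
      · simp [hk]
    simp only [key hij, key hij.symm]
    have h1 : ∀ i, ∀ k, k ≠ i → s k = Function.update s i (t i) k := by
      intro i k hk; simp [hk]
    rw [if_pos (h1 i), if_pos (h1 j)]
    simp only [Function.update_self, Function.update_of_ne hij, Function.update_of_ne hij.symm]
    have h2 : (∀ k, k ≠ i → k ≠ j → s k = t k) ↔ (∀ k, k ≠ j → k ≠ i → s k = t k) :=
      forall_congr' fun k => ⟨fun h a b => h b a, fun h a b => h b a⟩
    simp only [h2, if_true]
    ring
  · rintro ⟨c, d, r⟩ - hr
    contrapose! hr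
    simp only [liftA, liftB, Raux, MonoidHom.coe_mk, OneHom.coe_mk, Matrix.of_apply, ne_eq,
      mul_eq_zero, not_or, ite_eq_right_iff, one_ne_zero, imp_false, not_not] at hr
    obtain ⟨⟨⟨-, hs⟩, ha⟩, ⟨-, ht⟩, hb⟩ := hr
    refine Prod.ext ha.symm (Prod.ext hb (funext fun k => ?_))
    by_cases hk : k = j
    · subst hk; simpa using ht k hij.symm
    · simpa [hk] using (hs k hk).symm
  · simp
  · rintro ⟨c, d, r⟩ - hr
    contrapose! hr
    simp only [liftA, liftB, Raux, MonoidHom.coe_mk, OneHom.coe_mk, Matrix.of_apply, ne_eq,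
      mul_eq_zero, not_or, ite_eq_right_iff, one_ne_zero, imp_false, not_not] at hr
    obtain ⟨⟨⟨-, hs⟩, hb⟩, ⟨-, ht⟩, ha⟩ := hr
    refine Prod.ext ha (Prod.ext hb.symm (funext fun k => ?_))
    by_cases hk : k = i
    · subst hk; simpa using ht k hij
    · simpa [hk] using (hs k hk).symm
  · simp

/-- Exchange relations for factors at single indices give one for ordered products. -/
theorem exchange_list_prod {M ι : Type*} [Monoid M] (r : M) (f g : ι → M)
    (hr : ∀ i, r * f i * g i = g i * f i * r) (hfg : ∀ i j, i ≠ j → Commute (f i) (g j)) :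
    ∀ l : List ι, l.Nodup →
      r * (l.map f).prod * (l.map g).prod = (l.map g).prod * (l.map f).prod * r
  | [], _ => by simp
  | i :: l, hl => by
    obtain ⟨hi, hl⟩ := List.nodup_cons.1 hl
    have ih := exchange_list_prod r f g hr hfg l hl
    have hne : ∀ j ∈ l, i ≠ j := fun j hj h => hi (h ▸ hj)
    have hF : Commute (l.map f).prod (g i) := Commute.list_prod_left _ _ fun x hx => by
      obtain ⟨j, hj, rfl⟩ := List.mem_map.1 hx
      exact hfg j i (hne j hj).symm
    have hG : Commute (f i) (l.map g).prod := Commute.list_prod_right _ _ fun x hx => by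
      obtain ⟨j, hj, rfl⟩ := List.mem_map.1 hx
      exact hfg i j (hne j hj)
    simp only [List.map_cons, List.prod_cons]
    calc r * (f i * (l.map f).prod) * (g i * (l.map g).prod)
        = r * f i * ((l.map f).prod * g i) * (l.map g).prod := by simp only [mul_assoc]
      _ = r * f i * g i * (l.map f).prod * (l.map g).prod := by
          rw [hF.eq]; simp only [mul_assoc]
      _ = g i * f i * (r * (l.map f).prod * (l.map g).prod) := by
          rw [hr]; simp only [mul_assoc]
      _ = g i * (f i * (l.map g).prod) * (l.map f).prod * r := by
          rw [ih]; simp only [mul_assoc]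
      _ = g i * (l.map g).prod * (f i * (l.map f).prod) * r := by
          rw [hG.eq]; simp only [mul_assoc]

theorem map_monodromy {N : Type*} [Monoid N] (L : ℕ) (η lam : ℂ)
    (φ : Matrix (Fin 2 × Chain L) (Fin 2 × Chain L) ℂ →* N) :
    φ (monodromy L η lam) =
      ((List.finRange L).reverse.map fun j => φ (Raux L η lam j)).prod := by
  rw [monodromy, map_list_prod, List.ofFn_eq_map, ← List.map_reverse, List.map_map]
  rfl

/-- The RTT exchange relation
`R_{ab}(λ−μ) 𝒯_a(λ) 𝒯_b(μ) = 𝒯_b(μ) 𝒯_a(λ) R_{ab}(λ−μ)`. -/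
theorem RTT_relation (L : ℕ) (hL : 1 ≤ L) (η lam mu : ℂ)
    (h1 : Complex.sinh (lam + η) ≠ 0) (h2 : Complex.sinh (mu + η) ≠ 0)
    (h3 : Complex.sinh (lam - mu + η) ≠ 0) :
    Rab L η (lam - mu) * monodromyA L η lam * monodromyB L η mu =
      monodromyB L η mu * monodromyA L η lam * Rab L η (lam - mu) := by
  have hA : monodromyA L η lam = liftA (Chain L) (monodromy L η lam) := rfl
  have hB : monodromyB L η mu = liftB (Chain L) (monodromy L η mu) := rfl
  rw [hA, hB, map_monodromy, map_monodromy]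
  refine exchange_list_prod _ _ _ (fun j => ?_)
    (fun i j hij => commute_liftA_liftB_Raux L η lam mu hij) _
    (List.nodup_reverse.2 (List.nodup_finRange L))
  rw [Rab_eq_siteLift L η (lam - mu) j, liftA_Raux, liftB_Raux, ← siteLift_mul, ← siteLift_mul,
    yang_baxter η lam mu h1 h2 h3, siteLift_mul, siteLift_mul]
end

section
/- Let L ≥ 1, η ∈ ℂ, and λ, μ ∈ ℂ with sinh(λ+η) ≠ 0, sinh(μ+η) ≠ 0 and sinh(λ−μ+η) ≠ 0. Then the transfer matrices of the six-vertex model commute: T(λ) T(μ) = T(μ) T(λ) as operators on (ℂ²)^{⊗L}. -/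
open Complex Matrix

/-- The six-vertex weight matrix with weights `1`, `b`, `c`. -/
def sixVertex (b c : ℂ) : Matrix (Fin 2 × Fin 2) (Fin 2 × Fin 2) ℂ :=
  Matrix.of fun p q =>
    if p = q then (if p.1 = p.2 then 1 else b)
    else if p.1 = q.2 ∧ p.2 = q.1 ∧ p.1 ≠ p.2 then c else 0

theorem Rmat_eq_sixVertex (η lam : ℂ) :
    Rmat η lam = sixVertex (sinh lam / sinh (lam + η)) (sinh η / sinh (lam + η)) := rfl

set_option maxHeartbeats 4000000 in
theorem sixVertex_yangBaxter {b c b₁ c₁ b₂ c₂ : ℂ}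
    (hc : c₁ = b * c₁ * b₂ + c * c₂) (hb : b₁ * c₂ = b * c₂ + c * c₁ * b₂)
    (hbc : c * b₁ = c * b₂ + b * c₁ * c₂) (x y e f s t : Fin 2) :
    ∑ g, ∑ h, ∑ r, sixVertex b c (x, y) (g, h) *
        (sixVertex b₁ c₁ (g, s) (e, r) * sixVertex b₂ c₂ (h, r) (f, t)) =
      ∑ g, ∑ h, ∑ r, (sixVertex b₂ c₂ (y, s) (h, r) * sixVertex b₁ c₁ (x, r) (g, t)) *
        sixVertex b c (g, h) (e, f) := by
  fin_cases x <;> fin_cases y <;> fin_cases e <;> fin_cases f <;> fin_cases s <;> fin_cases t <;>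
    simp [sixVertex] <;> grind

theorem sinh_mul_sinh_add (x y z : ℂ) :
    sinh x * sinh (y + z) = sinh (x + z) * sinh y + sinh z * sinh (x - y) := by
  simp only [sinh_add, sinh_sub]
  ring

theorem Rmat_yangBaxter {η lam mu : ℂ} (h1 : sinh (lam + η) ≠ 0) (h2 : sinh (mu + η) ≠ 0)
    (h3 : sinh (lam - mu + η) ≠ 0) (x y e f s t : Fin 2) :
    ∑ g, ∑ h, ∑ r, Rmat η (lam - mu) (x, y) (g, h) *
        (Rmat η lam (g, s) (e, r) * Rmat η mu (h, r) (f, t)) =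
      ∑ g, ∑ h, ∑ r, (Rmat η mu (y, s) (h, r) * Rmat η lam (x, r) (g, t)) *
        Rmat η (lam - mu) (g, h) (e, f) := by
  simp only [Rmat_eq_sixVertex]
  have key₂ := sinh_mul_sinh_add lam (lam - mu) η
  have key₃ := sinh_mul_sinh_add lam mu η
  rw [sub_sub_cancel] at key₂
  apply sixVertex_yangBaxter
  · have key : sinh (lam - mu + η) * sinh (mu + η) =
        sinh (lam - mu) * sinh mu + sinh η * sinh (lam + η) := by
      rw [show lam + η = lam - mu + (mu + η) by ring]
      simp only [sinh_add, cosh_add]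
      linear_combination (sinh (lam - mu) * sinh mu) * cosh_sq η
    field_simp
    linear_combination sinh η * key
  · field_simp
    linear_combination sinh η * key₂
  · field_simp
    linear_combination sinh η * key₃

theorem Rmat_neg_mul_Rmat {η u : ℂ} (h : sinh (u + η) ≠ 0) (h' : sinh (-u + η) ≠ 0) :
    Rmat η (-u) * Rmat η u = 1 := by
  have key : sinh (u + η) * sinh (-u + η) = sinh η ^ 2 - sinh u ^ 2 := by
    simp only [sinh_add, sinh_neg, cosh_neg]
    linear_combination sinh η ^ 2 * cosh_sq u - sinh u ^ 2 * cosh_sq η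
  ext ⟨i, j⟩ ⟨k, l⟩
  fin_cases i <;> fin_cases j <;> fin_cases k <;> fin_cases l <;>
    simp [Rmat, Matrix.mul_apply, Fintype.sum_prod_type] <;> field_simp <;>
    first | linear_combination -key | ring1

section AuxiliaryTensor

variable {m A : Type*} [Fintype m] [Ring A]

/-- The product `M₁ N₂` of two operator-valued matrices acting on different auxiliary factors. -/
def auxMul (M N : Matrix m m A) : Matrix (m × m) (m × m) A :=
  Matrix.of fun p q => M p.1 q.1 * N p.2 q.2

/-- The product `N₂ M₁` of two operator-valued matrices acting on different auxiliary factors. -/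
def auxMulRev (M N : Matrix m m A) : Matrix (m × m) (m × m) A :=
  Matrix.of fun p q => N p.2 q.2 * M p.1 q.1

theorem auxMul_mul {M M' N N' : Matrix m m A} (h : ∀ i j k l, Commute (M' i j) (N k l)) :
    auxMul (M * M') (N * N') = auxMul M N * auxMul M' N' := by
  ext p q
  simp only [auxMul, Matrix.of_apply, Matrix.mul_apply, Fintype.sum_prod_type,
    Finset.sum_mul_sum]
  refine Finset.sum_congr rfl fun g _ => Finset.sum_congr rfl fun k _ => ?_
  rw [mul_assoc, ← mul_assoc (M' _ _), (h _ _ _ _).eq]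
  simp only [mul_assoc]

theorem auxMulRev_mul {M M' N N' : Matrix m m A} (h : ∀ i j k l, Commute (M i j) (N' k l)) :
    auxMulRev (M * M') (N * N') = auxMulRev M N * auxMulRev M' N' := by
  ext p q
  simp only [auxMulRev, Matrix.of_apply, Matrix.mul_apply, Fintype.sum_prod_type,
    Finset.sum_mul_sum]
  rw [Finset.sum_comm]
  refine Finset.sum_congr rfl fun g _ => Finset.sum_congr rfl fun k _ => ?_
  rw [mul_assoc, ← mul_assoc (N' _ _), ← (h _ _ _ _).eq]
  simp only [mul_assoc]

theorem trace_auxMul (M N : Matrix m m A) :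
    (auxMul M N).trace = M.trace * N.trace := by
  simp [auxMul, Matrix.trace, Fintype.sum_prod_type, Finset.sum_mul_sum]

theorem trace_auxMulRev (M N : Matrix m m A) :
    (auxMulRev M N).trace = N.trace * M.trace := by
  simp only [auxMulRev, Matrix.trace, Fintype.sum_prod_type, Finset.sum_mul_sum]
  exact Finset.sum_comm

/-- The RTT relation `X₁₂ M₁ N₂ = N₂ M₁ X₁₂`. -/
def RTT (X : Matrix (m × m) (m × m) A) (M N : Matrix m m A) : Prop :=
  X * auxMul M N = auxMulRev M N * X

theorem RTT.one [DecidableEq m] (X : Matrix (m × m) (m × m) A) : RTT X 1 1 := by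
  have h₁ : auxMul (1 : Matrix m m A) 1 = 1 := by
    ext ⟨i, j⟩ ⟨k, l⟩
    by_cases h : i = k <;> simp [auxMul, Matrix.one_apply, h]
  have h₂ : auxMulRev (1 : Matrix m m A) 1 = 1 := by
    ext ⟨i, j⟩ ⟨k, l⟩
    by_cases h : i = k <;> simp [auxMulRev, Matrix.one_apply, h]
  rw [RTT, h₁, h₂, mul_one, one_mul]

theorem RTT.mul {X : Matrix (m × m) (m × m) A} {M M' N N' : Matrix m m A}
    (h : RTT X M N) (h' : RTT X M' N') (hM' : ∀ i j k l, Commute (M' i j) (N k l))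
    (hM : ∀ i j k l, Commute (M i j) (N' k l)) : RTT X (M * M') (N * N') := by
  rw [RTT] at h h'
  rw [RTT, auxMul_mul hM', auxMulRev_mul hM, ← Matrix.mul_assoc, h, Matrix.mul_assoc, h',
    Matrix.mul_assoc]

theorem commute_list_prod_apply [DecidableEq m] {z : A} (l : List (Matrix m m A))
    (h : ∀ M ∈ l, ∀ i j, Commute z (M i j)) (i j : m) : Commute z (l.prod i j) := by
  induction l generalizing i j with
  | nil =>
    by_cases hij : i = j <;> simp [hij]
  | cons M l ih =>
    rw [List.prod_cons, Matrix.mul_apply]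
    exact Commute.sum_right _ _ _ fun k _ => (h M (by simp) i k).mul_right
      (ih (fun N hN => h N (List.mem_cons_of_mem _ hN)) k j)

theorem RTT.list_prod [DecidableEq m] {ι : Type*} {X : Matrix (m × m) (m × m) A}
    {M N : ι → Matrix m m A} (h : ∀ x, RTT X (M x) (N x))
    (hc : ∀ x y, x ≠ y → ∀ i j k l, Commute (M x i j) (N y k l))
    {s : List ι} (hs : s.Nodup) : RTT X (s.map M).prod (s.map N).prod := by
  induction s with
  | nil => exact RTT.one X
  | cons x s ih =>
    rw [List.nodup_cons] at hs
    have hne : ∀ y ∈ s, x ≠ y := fun y hy hxy => hs.1 (hxy ▸ hy)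
    simp only [List.map_cons, List.prod_cons]
    refine (h x).mul (ih hs.2) (fun i j k l => ?_) fun i j k l => ?_
    · refine (commute_list_prod_apply _ (fun P hP i j => ?_) i j).symm
      obtain ⟨y, hy, rfl⟩ := List.mem_map.1 hP
      exact (hc y x (hne y hy).symm _ _ _ _).symm
    · refine commute_list_prod_apply _ (fun P hP k l => ?_) k l
      obtain ⟨y, hy, rfl⟩ := List.mem_map.1 hP
      exact hc x y (hne y hy) _ _ _ _

theorem RTT.commute_trace [DecidableEq m] {R : Type*} [CommRing R] [Algebra R A]
    {X Y : Matrix (m × m) (m × m) R} (hYX : Y * X = 1) {M N : Matrix m m A}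
    (h : RTT (X.map (algebraMap R A)) M N) : Commute M.trace N.trace := by
  have hmap : ∀ {U V : Matrix (m × m) (m × m) R}, U * V = 1 →
      U.map (algebraMap R A) * V.map (algebraMap R A) = 1 := fun hUV => by
    rw [← Matrix.map_mul, hUV, Matrix.map_one _ (map_zero _) (map_one _)]
  have hcyc : ∀ Z : Matrix (m × m) (m × m) A,
      (Y.map (algebraMap R A) * Z).trace = (Z * Y.map (algebraMap R A)).trace := fun Z => by
    simp only [Matrix.trace, Matrix.diag_apply, Matrix.mul_apply, Matrix.map_apply]
    rw [Finset.sum_comm]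
    simp only [Algebra.commutes]
  rw [commute_iff_eq, ← trace_auxMul, ← trace_auxMulRev]
  calc (auxMul M N).trace
      = (Y.map (algebraMap R A) * (X.map (algebraMap R A) * auxMul M N)).trace := by
        rw [← Matrix.mul_assoc, hmap hYX, Matrix.one_mul]
    _ = (auxMulRev M N).trace := by
        rw [h, hcyc, Matrix.mul_assoc, hmap (mul_eq_one_comm.1 hYX), Matrix.mul_one]

end AuxiliaryTensor

/-- The operator on the chain acting by `P` on the `j`-th site and trivially elsewhere. -/
noncomputable def siteOp {L : ℕ} (j : Fin L) :
    Matrix (Fin 2) (Fin 2) ℂ →ₗ[ℂ] Matrix (Chain L) (Chain L) ℂ where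
  toFun P := Matrix.of fun v w => P (v j) (w j) * (if ∀ k, k ≠ j → v k = w k then 1 else 0)
  map_add' P Q := by ext v w; simp only [Matrix.of_apply, Matrix.add_apply, add_mul]
  map_smul' r P := by ext v w; simp

theorem siteOp_apply {L : ℕ} (j : Fin L) (P : Matrix (Fin 2) (Fin 2) ℂ) (v w : Chain L) :
    siteOp j P v w = P (v j) (w j) * (if ∀ k, k ≠ j → v k = w k then 1 else 0) := rfl

theorem siteOp_mul_apply {L : ℕ} (j : Fin L) (P : Matrix (Fin 2) (Fin 2) ℂ)
    (M : Matrix (Chain L) (Chain L) ℂ) (v w : Chain L) :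
    (siteOp j P * M) v w = ∑ s, P (v j) s * M (Function.update v j s) w := by
  rw [Matrix.mul_apply]
  symm
  refine Finset.sum_of_injOn (Function.update v j) (Function.update_injective v j).injOn
    (by simp) (fun u _ hu => ?_) fun s _ => ?_
  · rw [siteOp_apply, if_neg, mul_zero, zero_mul]
    intro h
    refine hu ⟨u j, by simp, ?_⟩
    ext k
    by_cases hk : k = j
    · subst hk; simp
    · simp [hk, h k hk]
  · rw [siteOp_apply, if_pos fun k hk => by simp [hk]]
    simp

theorem siteOp_mul {L : ℕ} (j : Fin L) (P Q : Matrix (Fin 2) (Fin 2) ℂ) :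
    siteOp j P * siteOp j Q = siteOp j (P * Q) := by
  ext v w
  rw [siteOp_mul_apply, siteOp_apply, Matrix.mul_apply, Finset.sum_mul]
  refine Finset.sum_congr rfl fun s _ => ?_
  have h : (∀ k, k ≠ j → Function.update v j s k = w k) ↔ ∀ k, k ≠ j → v k = w k :=
    forall₂_congr fun k hk => by rw [Function.update_of_ne hk]
  simp only [siteOp_apply, Function.update_self, h, mul_assoc]

theorem siteOp_mul_siteOp_apply {L : ℕ} {j k : Fin L} (hjk : j ≠ k)
    (P Q : Matrix (Fin 2) (Fin 2) ℂ) (v w : Chain L) :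
    (siteOp j P * siteOp k Q) v w =
      P (v j) (w j) * Q (v k) (w k) * (if ∀ i, i ≠ j → i ≠ k → v i = w i then 1 else 0) := by
  rw [siteOp_mul_apply, Finset.sum_eq_single (w j)]
  · have h : (∀ i, i ≠ k → Function.update v j (w j) i = w i) ↔
        ∀ i, i ≠ j → i ≠ k → v i = w i := by
      refine forall_congr' fun i => ?_
      by_cases hi : i = j
      · subst hi; simp
      · simp [hi]
    simp only [siteOp_apply, h, Function.update_of_ne hjk.symm, mul_assoc]
  · intro s _ hs
    rw [siteOp_apply, if_neg, mul_zero, mul_zero]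
    intro h
    exact hs (by simpa using h j hjk)
  · simp

theorem siteOp_commute {L : ℕ} {j k : Fin L} (hjk : j ≠ k) (P Q : Matrix (Fin 2) (Fin 2) ℂ) :
    Commute (siteOp j P) (siteOp k Q) := by
  ext v w
  have h : (∀ i, i ≠ j → i ≠ k → v i = w i) ↔ ∀ i, i ≠ k → i ≠ j → v i = w i :=
    forall_congr' fun i => ⟨fun h a b => h b a, fun h a b => h b a⟩
  simp only [siteOp_mul_siteOp_apply hjk, siteOp_mul_siteOp_apply hjk.symm, h,
    mul_comm (P _ _)]

/-- The Lax operator at site `j`: `R_{aj}(λ)` as an operator-valued matrix on the auxiliary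
factor. -/
noncomputable def lax (L : ℕ) (η lam : ℂ) (j : Fin L) :
    Matrix (Fin 2) (Fin 2) (Matrix (Chain L) (Chain L) ℂ) :=
  Matrix.of fun a b => siteOp j (Matrix.of fun s t => Rmat η lam (a, s) (b, t))

theorem lax_RTT {L : ℕ} {η lam mu : ℂ} (h1 : sinh (lam + η) ≠ 0) (h2 : sinh (mu + η) ≠ 0)
    (h3 : sinh (lam - mu + η) ≠ 0) (j : Fin L) :
    RTT ((Rmat η (lam - mu)).map (algebraMap ℂ (Matrix (Chain L) (Chain L) ℂ)))
      (lax L η lam j) (lax L η mu j) := by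
  ext1 ⟨x, y⟩ ⟨e, f⟩
  simp only [Matrix.mul_apply, auxMul, auxMulRev, lax, Matrix.of_apply, Matrix.map_apply,
    siteOp_mul, ← Algebra.commutes (R := ℂ), ← Algebra.smul_def, ← map_smul, ← map_sum]
  congr 1
  ext s t
  simp only [Fintype.sum_prod_type, Matrix.sum_apply, Matrix.smul_apply, Matrix.mul_apply,
    Matrix.of_apply, smul_eq_mul, Finset.mul_sum]
  refine (Rmat_yangBaxter h1 h2 h3 x y e f s t).trans ?_
  exact Finset.sum_congr rfl fun _ _ => Finset.sum_congr rfl fun _ _ =>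
    Finset.sum_congr rfl fun _ _ => mul_comm _ _

theorem comp_symm_monodromy (L : ℕ) (η lam : ℂ) :
    (Matrix.compRingEquiv (Fin 2) (Chain L) ℂ).symm (monodromy L η lam) =
      ((List.finRange L).reverse.map (lax L η lam)).prod := by
  rw [monodromy, map_list_prod, List.map_reverse, List.map_reverse, List.ofFn_eq_map,
    List.map_map]
  rfl

theorem transfer_eq_trace (L : ℕ) (η lam : ℂ) :
    transfer L η lam = ((List.finRange L).reverse.map (lax L η lam)).prod.trace := by
  rw [← comp_symm_monodromy]
  ext v w
  simp [transfer, Matrix.trace, Matrix.sum_apply, Matrix.comp_symm_apply]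

theorem transfer_commute_of_ne {L : ℕ} {η lam mu : ℂ} (h1 : sinh (lam + η) ≠ 0)
    (h2 : sinh (mu + η) ≠ 0) (h3 : sinh (lam - mu + η) ≠ 0) (h4 : sinh (lam - mu - η) ≠ 0) :
    Commute (transfer L η lam) (transfer L η mu) := by
  rw [transfer_eq_trace, transfer_eq_trace]
  have h4' : sinh (-(lam - mu) + η) ≠ 0 := by
    rwa [show -(lam - mu) + η = -(lam - mu - η) by ring, sinh_neg, neg_ne_zero]
  exact RTT.commute_trace (Rmat_neg_mul_Rmat h3 h4')
    (RTT.list_prod (lax_RTT h1 h2 h3) (fun x y hxy i j k l => siteOp_commute hxy _ _)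
      (List.nodup_reverse.2 (List.nodup_finRange L)))

theorem continuousAt_transfer {L : ℕ} {η mu : ℂ} (h : sinh (mu + η) ≠ 0) :
    ContinuousAt (transfer L η) mu := by
  have hR : ∀ p q, ContinuousAt (fun z => Rmat η z p q) mu := fun p q => by
    simp only [Rmat, Matrix.of_apply]
    split_ifs <;> fun_prop (disch := assumption)
  have hRaux : ∀ j, ContinuousAt (fun z => Raux L η z j) mu := fun j =>
    continuousAt_pi.2 fun p => continuousAt_pi.2 fun q => (hR _ _).mul continuousAt_const
  have hM : ContinuousAt (monodromy L η) mu := by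
    have := tendsto_list_prod (List.finRange L).reverse fun j _ => (hRaux j).tendsto
    simp only [ContinuousAt, funext fun z => show monodromy L η z =
      ((List.finRange L).reverse.map (Raux L η z)).prod by
        rw [monodromy, List.ofFn_eq_map, List.map_reverse]]
    exact this
  refine continuousAt_pi.2 fun v => continuousAt_pi.2 fun w => ?_
  simp only [transfer, Matrix.of_apply]
  exact tendsto_finsetSum _ fun a _ => continuousAt_pi.1 (continuousAt_pi.1 hM (a, v)) (a, w)

/-- The transfer matrices of the six-vertex model commute:
`T(λ) T(μ) = T(μ) T(λ)` on `(ℂ²)^{⊗L}`. -/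
theorem transfer_commute (L : ℕ) (hL : 1 ≤ L) (η lam mu : ℂ)
    (h1 : Complex.sinh (lam + η) ≠ 0) (h2 : Complex.sinh (mu + η) ≠ 0)
    (h3 : Complex.sinh (lam - mu + η) ≠ 0) :
    transfer L η lam * transfer L η mu = transfer L η mu * transfer L η lam := by
  by_cases h4 : sinh (lam - mu - η) = 0
  swap
  · exact transfer_commute_of_ne h1 h2 h3 h4
  have hcont := continuousAt_transfer (L := L) h2
  have hd : HasDerivAt (fun z => sinh (lam - z - η)) (cosh (lam - mu - η) * (-1)) mu :=
    (((hasDerivAt_id mu).const_sub lam).sub_const η).csinh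
  have hd0 : cosh (lam - mu - η) * (-1) ≠ 0 := by
    intro h
    have hsq := cosh_sq (lam - mu - η)
    simp_all
  have hev : ∀ᶠ z in nhdsWithin mu {mu}ᶜ,
      transfer L η lam * transfer L η z = transfer L η z * transfer L η lam := by
    have e2 : ∀ᶠ z in nhds mu, sinh (z + η) ≠ 0 :=
      ContinuousAt.eventually_ne (by fun_prop) h2
    have e3 : ∀ᶠ z in nhds mu, sinh (lam - z + η) ≠ 0 :=
      ContinuousAt.eventually_ne (by fun_prop) h3
    filter_upwards [e2.filter_mono nhdsWithin_le_nhds, e3.filter_mono nhdsWithin_le_nhds,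
      hd.eventually_ne hd0 (c := 0)] with z hz2 hz3 hz4
    exact transfer_commute_of_ne h1 hz2 hz3 hz4
  exact tendsto_nhds_unique_of_eventuallyEq
    ((continuousAt_const.mul hcont).tendsto.mono_left nhdsWithin_le_nhds)
    ((hcont.mul continuousAt_const).tendsto.mono_left nhdsWithin_le_nhds) hev
end
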